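/- arXiv:2103.06918 — 2 statements merged into one kernel-verified Lean document; each statement's English description precedes it below -/
import Mathlib

section
/- Let k ≥ 3 and let p = p_1 ⋯ p_n be a permutation avoiding A_{k,k-1}. Suppose some entry of p has rank at least k-1, and let j be the smallest index such that the rank of p_j is at least k-1. Define the permutation q = q_1 ⋯ q_n by q_m = p_m for m < j and q_m = p_{n + j - m} for j ≤ m ≤ n (i.e., q is obtained from p by reversing the suffix p_j p_{j+1} ⋯ p_n). Then q avoids A_{k,k}. -/
/-- A permutation `p` of length `n` contains the pattern `q` of length `k` if there
are positions `i₁ < i₂ < ⋯ < i_k` whose entries are order-isomorphic to `q`. -/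
def Contains {n k : ℕ} (p : Equiv.Perm (Fin n)) (q : Equiv.Perm (Fin k)) : Prop :=
  ∃ f : Fin k → Fin n, StrictMono f ∧ ∀ r s : Fin k, q r < q s ↔ p (f r) < p (f s)

/-- `p` avoids every pattern in the set `S` of patterns of length `k`. -/
def AvoidsSet {n k : ℕ} (p : Equiv.Perm (Fin n)) (S : Set (Equiv.Perm (Fin k))) : Prop :=
  ∀ q ∈ S, ¬ Contains p q

/-- `A_k`: the set of patterns of length `k` whose first `k-1` entries are increasing. -/
def Ak (k : ℕ) : Set (Equiv.Perm (Fin k)) :=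
  { q | ∀ r s : Fin k, (r : ℕ) < (s : ℕ) → (s : ℕ) < k - 1 → q r < q s }

/-- `A_{k,i}`: the set `A_k` with the pattern ending in `i` removed (entries of patterns
are thought of as `1`-indexed values `1,…,k`, so value `i` corresponds to `i-1 : Fin k`). -/
def Aki (k i : ℕ) : Set (Equiv.Perm (Fin k)) :=
  { q ∈ Ak k | ∀ j : Fin k, (j : ℕ) = k - 1 → (q j : ℕ) ≠ i - 1 }

/-- The number of permutations of length `n` avoiding the set of patterns `S`. -/
noncomputable def avSet (n : ℕ) {k : ℕ} (S : Set (Equiv.Perm (Fin k))) : ℕ :=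
  Nat.card { p : Equiv.Perm (Fin n) // AvoidsSet p S }

/-- The number of permutations of length `n` avoiding the single pattern `q`. -/
noncomputable def avPat (n : ℕ) {k : ℕ} (q : Equiv.Perm (Fin k)) : ℕ :=
  Nat.card { p : Equiv.Perm (Fin n) // ¬ Contains p q }

/-- The rank of the entry in position `j` of `p`: the length of the longest increasing
subsequence of `p` ending in `p j`. -/
noncomputable def rank {n : ℕ} (p : Equiv.Perm (Fin n)) (j : Fin n) : ℕ :=
  sSup { m : ℕ | ∃ f : Fin m → Fin n, StrictMono f ∧ StrictMono (p ∘ f) ∧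
    (∀ r, f r ≤ j) ∧ (∃ r, f r = j) }

theorem rank_bdd {n : ℕ} (p : Equiv.Perm (Fin n)) (j : Fin n) :
    BddAbove { m : ℕ | ∃ f : Fin m → Fin n, StrictMono f ∧ StrictMono (p ∘ f) ∧
      (∀ r, f r ≤ j) ∧ (∃ r, f r = j) } := by
  refine ⟨n, ?_⟩
  rintro m ⟨f, hf, -⟩
  simpa using Fintype.card_le_of_injective f hf.injective

theorem le_rank {n m : ℕ} (p : Equiv.Perm (Fin n)) (j : Fin n) (f : Fin m → Fin n)
    (h1 : StrictMono f) (h2 : StrictMono (p ∘ f)) (h3 : ∀ r, f r ≤ j) (h4 : ∃ r, f r = j) :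
    m ≤ rank p j :=
  le_csSup (rank_bdd p j) ⟨f, h1, h2, h3, h4⟩

theorem exists_of_rank {n k : ℕ} (p : Equiv.Perm (Fin n)) (j : Fin n) (hk : 0 < k)
    (h : k ≤ rank p j) :
    ∃ f : Fin k → Fin n, StrictMono f ∧ StrictMono (p ∘ f) ∧ f ⟨k - 1, by omega⟩ = j := by
  have hne : { m : ℕ | ∃ f : Fin m → Fin n, StrictMono f ∧ StrictMono (p ∘ f) ∧
      (∀ r, f r ≤ j) ∧ (∃ r, f r = j) }.Nonempty := by
    by_contra hc
    rw [Set.not_nonempty_iff_eq_empty] at hc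
    rw [rank, hc] at h
    simp at h
    omega
  obtain ⟨f, h1, h2, h3, r, h4⟩ := Nat.sSup_mem hne (rank_bdd p j)
  change k ≤ sSup _ at h
  generalize sSup { m : ℕ | ∃ f : Fin m → Fin n, StrictMono f ∧ StrictMono (p ∘ f) ∧
      (∀ r, f r ≤ j) ∧ (∃ r, f r = j) } = M at *
  have hm : StrictMono (fun i : Fin k => (⟨i + (M - k), by omega⟩ : Fin M)) := by
    intro a b hab
    simp only [Fin.lt_def] at hab ⊢
    omega
  refine ⟨_, h1.comp hm, h2.comp hm, ?_⟩
  apply le_antisymm (h3 _)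
  rw [← h4]
  apply h1.monotone
  simp only [Fin.le_def]
  omega

theorem key {n k : ℕ} (hk : 3 ≤ k) (p : Equiv.Perm (Fin n))
    (hp : AvoidsSet p (Aki k (k - 1))) (g : Fin k → Fin n) (hg : StrictMono g)
    (hinc : ∀ r s : Fin k, (r : ℕ) < (s : ℕ) → (s : ℕ) < k - 1 → p (g r) < p (g s)) :
    p (g ⟨k - 3, by omega⟩) < p (g ⟨k - 1, by omega⟩) ∧
    p (g ⟨k - 1, by omega⟩) < p (g ⟨k - 2, by omega⟩) := by
  have hinj : Function.Injective (p ∘ g) := p.injective.comp hg.injective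
  have hs : StrictMono ((p ∘ g) ∘ Tuple.sort (p ∘ g)) :=
    (Tuple.monotone_sort (p ∘ g)).strictMono_of_injective
      (hinj.comp (Tuple.sort (p ∘ g)).injective)
  set q := (Tuple.sort (p ∘ g)).symm with hq
  have hiff : ∀ r s : Fin k, q r < q s ↔ p (g r) < p (g s) := by
    intro r s
    rw [← hs.lt_iff_lt]
    simp [hq]
  have hqinc : ∀ r s : Fin k, (r : ℕ) < (s : ℕ) → (s : ℕ) < k - 1 → q r < q s :=
    fun r s h1 h2 => (hiff r s).2 (hinc r s h1 h2)
  have hlast : (q ⟨k - 1, by omega⟩ : ℕ) = k - 2 := by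
    by_contra hne
    refine hp q ⟨hqinc, ?_⟩ ⟨g, hg, hiff⟩
    intro j hj
    have : j = ⟨k - 1, Nat.sub_lt (by omega) one_pos⟩ := Fin.ext hj
    rw [this]
    omega
  have h2 : (q ⟨k - 2, by omega⟩ : ℕ) = k - 1 := by
    obtain ⟨r, hr⟩ := q.surjective ⟨k - 1, by omega⟩
    have hrv : (q r : ℕ) = k - 1 := by rw [hr]
    rcases lt_trichotomy (r : ℕ) (k - 2) with h | h | h
    · have := hqinc r ⟨k - 2, by omega⟩ h (by simp only; omega)
      rw [Fin.lt_def] at this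
      omega
    · have : r = ⟨k - 2, by omega⟩ := Fin.ext h
      rw [← this, hrv]
    · have : r = ⟨k - 1, by omega⟩ := Fin.ext (by simp only; omega)
      rw [this] at hrv
      omega
  have h3 := hqinc ⟨k - 3, by omega⟩ ⟨k - 2, by omega⟩ (by simp only; omega) (by simp only; omega)
  have h4 : (q ⟨k - 3, by omega⟩ : ℕ) ≠ q ⟨k - 1, by omega⟩ := by
    intro h
    have := q.injective (Fin.ext h)
    simp only [Fin.mk.injEq] at this
    omega
  rw [← hiff, ← hiff]
  simp only [Fin.lt_def] at h3 ⊢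
  omega

theorem key2 {n k : ℕ} (hk : 3 ≤ k) (p : Equiv.Perm (Fin n))
    (hp : AvoidsSet p (Aki k (k - 1))) (f : Fin (k - 1) → Fin n) (hf : StrictMono f)
    (hpf : StrictMono (p ∘ f)) (x y : Fin n) (hx : f ⟨k - 1 - 1, by omega⟩ ≤ x) (hxy : x < y)
    (hpx : p (f ⟨k - 3, by omega⟩) < p x) :
    p (f ⟨k - 3, by omega⟩) < p y ∧ p y < p x := by
  let g : Fin k → Fin n := fun i =>
    if h : (i : ℕ) < k - 2 then f ⟨i, by omega⟩ else if (i : ℕ) = k - 2 then x else y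
  have hfx : ∀ i : Fin (k - 1), (i : ℕ) < k - 2 → f i < x := by
    intro i hi
    refine lt_of_lt_of_le (hf ?_) hx
    simp only [Fin.lt_def]
    omega
  have hg : StrictMono g := by
    intro a b hab
    have hab' : (a : ℕ) < b := hab
    simp only [g]
    split_ifs with h1 h2 h3 h4 h5 h6
    · exact hf hab
    · exact hfx _ h1
    · exact (hfx _ h1).trans hxy
    all_goals first | omega | exact hxy
  have hinc : ∀ r s : Fin k, (r : ℕ) < (s : ℕ) → (s : ℕ) < k - 1 → p (g r) < p (g s) := by
    intro a b hab hb
    simp only [g]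
    split_ifs with h1 h2 h3 h4 h5 h6
    · exact hpf hab
    · refine lt_of_le_of_lt (hpf.monotone (b := ⟨k - 3, by omega⟩) ?_) hpx
      simp only [Fin.le_def]
      omega
    all_goals omega
  have := key hk p hp g hg hinc
  have e1 : g ⟨k - 3, by omega⟩ = f ⟨k - 3, by omega⟩ := by
    simp only [g]; rw [dif_pos (by omega)]
  have e2 : g ⟨k - 2, by omega⟩ = x := by
    simp only [g]; rw [dif_neg (by omega), if_pos trivial]
  have e3 : g ⟨k - 1, by omega⟩ = y := by
    simp only [g]; rw [dif_neg (by omega), if_neg (by omega)]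
  rwa [e1, e2, e3] at this

/-- Reversing the suffix of a permutation avoiding `A_{k,k-1}` starting at the first
position of rank at least `k-1` yields a permutation avoiding `A_{k,k}`. -/
theorem stmt13 (k n : ℕ) (hk : 3 ≤ k) (p q : Equiv.Perm (Fin n))
    (hp : AvoidsSet p (Aki k (k - 1))) (j : Fin n)
    (hj : k - 1 ≤ rank p j) (hmin : ∀ m : Fin n, m < j → rank p m < k - 1)
    (hq1 : ∀ m : Fin n, m < j → q m = p m)
    (hq2 : ∀ m : Fin n, ∀ hjm : (j : ℕ) ≤ (m : ℕ),
      q m = p ⟨n - 1 + (j : ℕ) - (m : ℕ), by have hmn := m.isLt; omega⟩) :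
    AvoidsSet q (Aki k k) := by
  obtain ⟨f, hf, hpf, hfj⟩ := exists_of_rank p j (by omega : 0 < k - 1) hj
  have hj3 : p (f ⟨k - 3, by omega⟩) < p j := by
    rw [← hfj]
    apply hpf
    simp only [Fin.lt_def]
    omega
  have hdec : ∀ x y : Fin n, j ≤ x → x < y → p y < p x := by
    intro x y hx hxy
    rcases hx.eq_or_lt with rfl | hlt
    · exact (key2 hk p hp f hf hpf j y hfj.le hxy hj3).2
    · have := (key2 hk p hp f hf hpf j x hfj.le hlt hj3).1
      exact (key2 hk p hp f hf hpf x y (hfj.le.trans hx) hxy this).2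
  rintro t ⟨ht1, ht2⟩ ⟨g, hg, hiff⟩
  by_cases hc : g ⟨k - 2, by omega⟩ < j
  · have hm : StrictMono (fun i : Fin (k - 1) => (⟨i, by omega⟩ : Fin k)) := fun a b hab => hab
    have hle : ∀ i : Fin (k - 1), g ⟨i, by omega⟩ ≤ g ⟨k - 2, by omega⟩ := by
      intro i
      apply hg.monotone
      simp only [Fin.le_def]
      omega
    have := le_rank p (g ⟨k - 2, by omega⟩) _ (hg.comp hm) ?_ hle ⟨⟨k - 2, by omega⟩, rfl⟩
    · exact absurd (hmin _ hc) (by omega)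
    · intro a b hab
      have := (hiff _ _).1 (ht1 ⟨a, by omega⟩ ⟨b, by omega⟩ hab b.isLt)
      rwa [hq1 _ ((hle a).trans_lt hc), hq1 _ ((hle b).trans_lt hc)] at this
  · rw [not_lt] at hc
    have hlt : g ⟨k - 2, by omega⟩ < g ⟨k - 1, by omega⟩ := by
      apply hg
      simp only [Fin.lt_def]
      omega
    have hc2 := hc.trans hlt.le
    have hqlt : q (g ⟨k - 2, by omega⟩) < q (g ⟨k - 1, by omega⟩) := by
      rw [hq2 _ hc, hq2 _ hc2]
      apply hdec
      · simp only [Fin.le_def]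
        omega
      · simp only [Fin.lt_def] at hlt ⊢
        omega
    have htl := (hiff _ _).2 hqlt
    have hne := ht2 ⟨k - 1, by omega⟩ rfl
    obtain ⟨r, hr⟩ := t.surjective ⟨k - 1, by omega⟩
    have hrv : (t r : ℕ) = k - 1 := by rw [hr]
    rcases lt_trichotomy (r : ℕ) (k - 2) with h | h | h
    · have := ht1 r ⟨k - 2, by omega⟩ h (by simp only; omega)
      rw [Fin.lt_def] at this
      omega
    · have : r = ⟨k - 2, by omega⟩ := Fin.ext h
      rw [← this, Fin.lt_def] at htl
      omega
    · have : r = ⟨k - 1, by omega⟩ := Fin.ext (by simp only; omega)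
      rw [this] at hrv
      omega
end

section
/- For every integer k ≥ 3 there exists an integer N such that for all n ≥ N, the number of permutations of length n avoiding A_{k,k-1} is strictly less than the number of permutations of length n avoiding A_{k,k}: av_n(A_{k,k-1}) < av_n(A_{k,k}). -/
namespace PatAv

/-- There is an increasing subsequence of length `m+2` ending in position `j`. -/
def L {n : ℕ} (m : ℕ) (p : Equiv.Perm (Fin n)) (j : Fin n) : Prop :=
  ∃ g : Fin (m + 2) → Fin n, StrictMono g ∧ StrictMono (p ∘ g) ∧ g (Fin.last _) = j

/-- Reformulation of avoiding `A_{k,k}`. -/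
def AV1 {n : ℕ} (m : ℕ) (p : Equiv.Perm (Fin n)) : Prop :=
  ∀ g : Fin (m + 2) → Fin n, StrictMono g → StrictMono (p ∘ g) →
    ∀ x, g (Fin.last _) < x → p (g (Fin.last _)) < p x

/-- Reformulation of avoiding `A_{k,k-1}`. -/
def AV2 {n : ℕ} (m : ℕ) (p : Equiv.Perm (Fin n)) : Prop :=
  ∀ g : Fin (m + 2) → Fin n, StrictMono g → StrictMono (p ∘ g) →
    ∀ x, g (Fin.last _) < x → p (g (Fin.last m).castSucc) < p x ∧ p x < p (g (Fin.last _))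

lemma ak_ge {m : ℕ} {q : Equiv.Perm (Fin (m + 3))} (hq : q ∈ Ak (m + 3)) :
    ∀ (i : ℕ) (hi : i < m + 2), i ≤ (q ⟨i, by omega⟩ : ℕ) := by
  intro i
  induction i with
  | zero => intro _; omega
  | succ i ih =>
    intro hi
    have h1 := ih (by omega)
    have h2 := hq ⟨i, by omega⟩ ⟨i + 1, by omega⟩ (by simp) (by simpa using hi)
    rw [Fin.lt_def] at h2
    omega

lemma last1 {m : ℕ} {q : Equiv.Perm (Fin (m + 3))} (hq : q ∈ Ak (m + 3)) :
    (q (Fin.last _) : ℕ) = m + 2 ↔ q ⟨m + 1, by omega⟩ < q (Fin.last _) := by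
  have h0 := ak_ge hq (m + 1) (by omega)
  have hne : q ⟨m + 1, by omega⟩ ≠ q (Fin.last _) := by
    intro h
    have := q.injective h
    rw [Fin.ext_iff] at this
    simp at this
  rw [Fin.lt_def]
  rw [Ne, Fin.ext_iff] at hne
  omega

lemma last2 {m : ℕ} {q : Equiv.Perm (Fin (m + 3))} (hq : q ∈ Ak (m + 3)) :
    (q (Fin.last _) : ℕ) = m + 1 ↔
      (q ⟨m, by omega⟩ < q (Fin.last _) ∧ q (Fin.last _) < q ⟨m + 1, by omega⟩) := by
  have h0 := ak_ge hq m (by omega)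
  have hlt := hq ⟨m, by omega⟩ ⟨m + 1, by omega⟩ (by simp) (by simp)
  have hne : q ⟨m, by omega⟩ ≠ q (Fin.last _) := by
    intro h
    have := q.injective h
    rw [Fin.ext_iff] at this
    simp at this
  rw [Ne, Fin.ext_iff] at hne
  constructor
  · intro h
    obtain ⟨t, ht⟩ := q.surjective (Fin.last _)
    have ht' : t = ⟨m + 1, by omega⟩ := by
      rcases lt_trichotomy (t : ℕ) (m + 1) with h1 | h1 | h1
      · have := hq t ⟨m + 1, by omega⟩ h1 (by simp)
        rw [ht] at this
        exact absurd this (not_lt.2 (Fin.le_last _))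
      · exact Fin.ext h1
      · have : t = Fin.last _ := Fin.ext (by simp; omega)
        rw [← this, ht] at h
        simp at h
    rw [ht'] at ht
    rw [ht] at hlt ⊢
    simp only [Fin.lt_def, Fin.val_last] at *
    omega
  · simp only [Fin.lt_def]
    omega

lemma exists_pattern {n k : ℕ} (p : Equiv.Perm (Fin n)) (f : Fin k → Fin n) (hf : StrictMono f) :
    ∃ q : Equiv.Perm (Fin k), ∀ r s : Fin k, q r < q s ↔ p (f r) < p (f s) := by
  have hinj : Function.Injective (p ∘ f) := p.injective.comp hf.injective
  have hm : StrictMono ((p ∘ f) ∘ Tuple.sort (p ∘ f)) :=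
    (Tuple.monotone_sort (p ∘ f)).strictMono_of_injective
      (hinj.comp (Tuple.sort (p ∘ f)).injective)
  refine ⟨(Tuple.sort (p ∘ f)).symm, fun r s => ?_⟩
  rw [← hm.lt_iff_lt]
  simp

lemma snoc_mono {n m : ℕ} {g : Fin (m + 2) → Fin n} (hg : StrictMono g) {x : Fin n}
    (hx : g (Fin.last _) < x) : StrictMono (Fin.snoc g x : Fin (m + 3) → Fin n) := by
  intro a b hab
  induction b using Fin.lastCases with
  | last =>
    induction a using Fin.lastCases with
    | last => exact absurd hab (lt_irrefl _)
    | cast a =>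
      simp only [Fin.snoc_castSucc, Fin.snoc_last]
      exact lt_of_le_of_lt (hg.monotone (Fin.le_last _)) hx
  | cast b =>
    induction a using Fin.lastCases with
    | last => exact absurd hab (not_lt.2 (Fin.le_last _))
    | cast a =>
      simp only [Fin.snoc_castSucc]
      exact hg (by simpa using hab)

/-- The general shape of avoidance of subsets of `A_k`. -/
lemma avoid_iff {n m : ℕ} (p : Equiv.Perm (Fin n)) (i : ℕ) :
    AvoidsSet p (Aki (m + 3) i) ↔ ∀ g : Fin (m + 2) → Fin n, StrictMono g → StrictMono (p ∘ g) →
      ∀ x, g (Fin.last _) < x → ∃ q ∈ Ak (m + 3),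
        (∀ r s, q r < q s ↔ p ((Fin.snoc g x : Fin (m + 3) → Fin n) r) <
          p ((Fin.snoc g x : Fin (m + 3) → Fin n) s)) ∧
        (q (Fin.last _) : ℕ) = i - 1 := by
  constructor
  · intro h g hg hpg x hx
    have hs := snoc_mono hg hx
    obtain ⟨q, hq⟩ := exists_pattern p _ hs
    have hA : q ∈ Ak (m + 3) := by
      intro r s hrs hsk
      rw [hq]
      obtain ⟨r', rfl⟩ : ∃ r' : Fin (m + 2), r = r'.castSucc :=
        ⟨⟨r, by omega⟩, rfl⟩
      obtain ⟨s', rfl⟩ : ∃ s' : Fin (m + 2), s = s'.castSucc :=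
        ⟨⟨s, by omega⟩, rfl⟩
      simp only [Fin.snoc_castSucc]
      exact hpg hrs
    refine ⟨q, hA, hq, ?_⟩
    by_contra hne
    refine h q ⟨hA, ?_⟩ ⟨_, hs, hq⟩
    intro j hj
    have : j = Fin.last _ := Fin.ext (by simpa using hj)
    rw [this]; exact hne
  · rintro h q ⟨hA, hl⟩ ⟨f, hf, hq⟩
    have hfs : f = (Fin.snoc (fun a : Fin (m + 2) => f a.castSucc) (f (Fin.last _)) :
        Fin (m + 3) → Fin n) := by
      funext a
      induction a using Fin.lastCases with
      | last => simp
      | cast a => simp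
    obtain ⟨q', hA', hq', hl'⟩ := h (fun a => f a.castSucc)
      (fun a b hab => hf (by simpa using hab))
      (fun a b hab => by
        simp only [Function.comp]
        rw [← hq]
        exact hA _ _ hab (by simp))
      (f (Fin.last _)) (hf (Fin.castSucc_lt_last _))
    rw [← hfs] at hq'
    have hm : StrictMono (q.symm.trans q') := by
      intro a b hab
      simp only [Equiv.trans_apply]
      rw [hq', ← hq]
      simpa using hab
    have hid : ∀ a, (q.symm.trans q') a = a := by
      intro a
      have := congrFun (Subsingleton.elim (hm.orderIsoOfSurjective _ (Equiv.surjective _))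
        (OrderIso.refl (Fin (m + 3))) ▸ rfl :
        ((hm.orderIsoOfSurjective _ (Equiv.surjective _)) : Fin (m + 3) → Fin (m + 3)) =
        (OrderIso.refl (Fin (m + 3)) : Fin (m + 3) → Fin (m + 3))) a
      simpa using this
    have h1 := hid (q (Fin.last _))
    simp only [Equiv.trans_apply, Equiv.symm_apply_apply] at h1
    exact hl (Fin.last _) (by simp) (by rw [← h1]; exact hl')

lemma ex_pat {n m : ℕ} (p : Equiv.Perm (Fin n)) {g : Fin (m + 2) → Fin n} (hg : StrictMono g)
    (hpg : StrictMono (p ∘ g)) {x : Fin n} (hx : g (Fin.last _) < x) :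
    ∃ q ∈ Ak (m + 3),
        (∀ r s, q r < q s ↔ p ((Fin.snoc g x : Fin (m + 3) → Fin n) r) <
          p ((Fin.snoc g x : Fin (m + 3) → Fin n) s)) := by
  obtain ⟨q, hq⟩ := exists_pattern p _ (snoc_mono hg hx)
  refine ⟨q, ?_, hq⟩
  intro r s hrs hsk
  rw [hq]
  obtain ⟨r', rfl⟩ : ∃ r' : Fin (m + 2), r = r'.castSucc := ⟨⟨r, by omega⟩, rfl⟩
  obtain ⟨s', rfl⟩ : ∃ s' : Fin (m + 2), s = s'.castSucc := ⟨⟨s, by omega⟩, rfl⟩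
  simp only [Fin.snoc_castSucc]
  exact hpg hrs

lemma snoc_a {n m : ℕ} (g : Fin (m + 2) → Fin n) (x : Fin n) :
    (Fin.snoc g x : Fin (m + 3) → Fin n) ⟨m + 1, by omega⟩ = g (Fin.last _) :=
  Fin.snoc_castSucc (α := fun _ => Fin n) x g (Fin.last _)

lemma snoc_b {n m : ℕ} (g : Fin (m + 2) → Fin n) (x : Fin n) :
    (Fin.snoc g x : Fin (m + 3) → Fin n) ⟨m, by omega⟩ = g (Fin.last m).castSucc :=
  Fin.snoc_castSucc (α := fun _ => Fin n) x g (Fin.last m).castSucc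

lemma av1_iff {n m : ℕ} (p : Equiv.Perm (Fin n)) :
    AvoidsSet p (Aki (m + 3) (m + 3)) ↔ AV1 m p := by
  rw [avoid_iff]
  constructor
  · intro h g hg hpg x hx
    obtain ⟨q, hA, hq, hl⟩ := h g hg hpg x hx
    have := (last1 hA).1 (by omega)
    rw [hq, snoc_a] at this
    simpa using this
  · intro h g hg hpg x hx
    obtain ⟨q, hA, hq⟩ := ex_pat p hg hpg hx
    refine ⟨q, hA, hq, ?_⟩
    have := (last1 hA).2 (by rw [hq, snoc_a]; simpa using h g hg hpg x hx)
    omega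

lemma av2_iff {n m : ℕ} (p : Equiv.Perm (Fin n)) :
    AvoidsSet p (Aki (m + 3) (m + 3 - 1)) ↔ AV2 m p := by
  rw [avoid_iff]
  constructor
  · intro h g hg hpg x hx
    obtain ⟨q, hA, hq, hl⟩ := h g hg hpg x hx
    have := (last2 hA).1 (by omega)
    rw [hq, hq, snoc_a, snoc_b] at this
    simpa using this
  · intro h g hg hpg x hx
    obtain ⟨q, hA, hq⟩ := ex_pat p hg hpg hx
    refine ⟨q, hA, hq, ?_⟩
    have := (last2 hA).2 (by rw [hq, hq, snoc_a, snoc_b]; simpa using h g hg hpg x hx)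
    omega

/-- Reversal of the positions `t, …, n-1`. -/
def rvFun (n t : ℕ) (i : Fin n) : Fin n :=
  if h : i.val < t then i else ⟨n - 1 + t - i.val, by omega⟩

/-- Reversal of the positions `t, …, n-1`, as a permutation. -/
def rv (n t : ℕ) : Equiv.Perm (Fin n) :=
  Function.Involutive.toPerm (rvFun n t) (by
    intro i
    unfold rvFun
    split_ifs with h1 h2 <;> simp only [Fin.ext_iff] at * <;> omega)

lemma rv_lt {n t : ℕ} {i : Fin n} (h : i.val < t) : rv n t i = i := by
  change rvFun n t i = i
  simp [rvFun, h]

lemma rv_ge {n t : ℕ} {i : Fin n} (h : t ≤ i.val) : (rv n t i : ℕ) = n - 1 + t - i.val := by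
  change (rvFun n t i : ℕ) = _
  simp [rvFun, not_lt.2 h]

/-- `t` is the first position where an increasing subsequence of length `m+2` ends
(or `n` if there is none). -/
def First {n : ℕ} (m : ℕ) (p : Equiv.Perm (Fin n)) (t : ℕ) : Prop :=
  t ≤ n ∧ (∀ j : Fin n, j.val < t → ¬ L m p j) ∧ ∀ h : t < n, L m p ⟨t, h⟩

lemma first_unique {n m : ℕ} {p : Equiv.Perm (Fin n)} {t t' : ℕ} (h : First m p t)
    (h' : First m p t') : t = t' := by
  rcases lt_trichotomy t t' with h1 | h1 | h1
  · exact absurd (h.2.2 (by have := h'.1; omega)) (h'.2.1 _ h1)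
  · exact h1
  · exact absurd (h'.2.2 (by have := h.1; omega)) (h.2.1 _ h1)

lemma first_exists {n m : ℕ} (p : Equiv.Perm (Fin n)) : ∃ t, First m p t := by
  classical
  have hex : ∃ t, ∀ h : t < n, L m p ⟨t, h⟩ := ⟨n, fun h => absurd h (lt_irrefl _)⟩
  refine ⟨Nat.find hex, ?_, ?_, Nat.find_spec hex⟩
  · exact Nat.find_le (n := n) (fun h => absurd h (lt_irrefl _))
  · intro j hj hL
    exact Nat.find_min hex hj (fun _ => hL)

lemma replace_last {n m : ℕ} {p p' : Equiv.Perm (Fin n)} {g : Fin (m + 2) → Fin n}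
    (hg : StrictMono g) (hpg : StrictMono (p ∘ g)) {x : Fin n}
    (hpp : ∀ j, j < g (Fin.last _) → p' j = p j)
    (h1 : g (Fin.last _) ≤ x) (h2 : p (g (Fin.last m).castSucc) < p' x) :
    ∃ g' : Fin (m + 2) → Fin n, StrictMono g' ∧ StrictMono (p' ∘ g') ∧ g' (Fin.last _) = x := by
  have hlt : ∀ a : Fin (m + 1), g a.castSucc < g (Fin.last _) := fun a =>
    hg (Fin.castSucc_lt_last _)
  refine ⟨Fin.snoc (α := fun _ => Fin n) (fun a : Fin (m + 1) => g a.castSucc) x, ?_, ?_, by simp⟩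
  · intro a b hab
    induction b using Fin.lastCases with
    | last =>
      induction a using Fin.lastCases with
      | last => exact absurd hab (lt_irrefl _)
      | cast a =>
        simp only [Fin.snoc_castSucc, Fin.snoc_last]
        exact lt_of_lt_of_le (hlt a) h1
    | cast b =>
      induction a using Fin.lastCases with
      | last => exact absurd hab (not_lt.2 (Fin.le_last _))
      | cast a =>
        simp only [Fin.snoc_castSucc]
        exact hg hab
  · intro a b hab
    induction b using Fin.lastCases with
    | last =>
      induction a using Fin.lastCases with
      | last => exact absurd hab (lt_irrefl _)
      | cast a =>
        simp only [Function.comp, Fin.snoc_castSucc, Fin.snoc_last]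
        rw [hpp _ (hlt a)]
        refine lt_of_le_of_lt (hpg.monotone ?_) h2
        exact Fin.castSucc_le_castSucc_iff.2 (Fin.le_last a)
    | cast b =>
      induction a using Fin.lastCases with
      | last => exact absurd hab (not_lt.2 (Fin.le_last _))
      | cast a =>
        simp only [Function.comp, Fin.snoc_castSucc]
        rw [hpp _ (hlt a), hpp _ (hlt b)]
        exact hpg hab

lemma L_congr {n m : ℕ} {p p' : Equiv.Perm (Fin n)} {j : Fin n}
    (h : ∀ i, i ≤ j → p' i = p i) (hL : L m p' j) : L m p j := by
  obtain ⟨g, hg, hpg, hj⟩ := hL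
  refine ⟨g, hg, ?_, hj⟩
  intro a b hab
  have := hpg hab
  simp only [Function.comp] at *
  rwa [h, h] at this <;> rw [← hj] <;> exact hg.monotone (Fin.le_last _)

lemma main {n m : ℕ} {p : Equiv.Perm (Fin n)} {t : ℕ} (hp : AV2 m p) (ht : First m p t) :
    AV1 m (p * rv n t) ∧ First m (p * rv n t) t := by
  have hagree : ∀ i : Fin n, i.val < t → (p * rv n t) i = p i := by
    intro i hi
    rw [Equiv.Perm.mul_apply, rv_lt hi]
  have hno : ∀ j : Fin n, j.val < t → ¬ L m (p * rv n t) j := by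
    intro j hj hL
    exact ht.2.1 j hj (L_congr (fun i hi => hagree i (lt_of_le_of_lt hi hj)) hL)
  have hdec : ∀ x y : Fin n, t ≤ x.val → x < y → p y < p x := by
    intro x y hx hxy
    obtain ⟨g, hg, hpg, hl⟩ := ht.2.2 (lt_of_le_of_lt hx x.2)
    rcases eq_or_lt_of_le hx with h | h
    · have : g (Fin.last _) = x := by rw [hl]; exact Fin.ext h
      rw [← this] at hxy ⊢
      exact (hp g hg hpg y hxy).2
    · have hx' : g (Fin.last _) < x := by rw [hl]; exact h
      obtain ⟨g', hg', hpg', hl'⟩ := replace_last (p' := p) hg hpg (fun _ _ => rfl) hx'.le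
        (hp g hg hpg x hx').1
      rw [← hl'] at hxy ⊢
      exact (hp g' hg' hpg' y hxy).2
  refine ⟨?_, ht.1, hno, ?_⟩
  · intro g hg hpg x hx
    have hge : t ≤ (g (Fin.last _)).val := by
      by_contra hlt
      exact hno _ (not_le.1 hlt) ⟨g, hg, hpg, rfl⟩
    have hx2 : (g (Fin.last _)).val < x.val := hx
    have e1 := rv_ge (n := n) hge
    have e2 := rv_ge (n := n) (i := x) (t := t) (by omega)
    rw [Equiv.Perm.mul_apply, Equiv.Perm.mul_apply]
    apply hdec
    · omega
    · rw [Fin.lt_def]; omega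
  · intro htn
    obtain ⟨g, hg, hpg, hl⟩ := ht.2.2 htn
    refine replace_last hg hpg (fun j hj => hagree j (by rw [hl] at hj; exact hj)) hl.le ?_
    rw [Equiv.Perm.mul_apply]
    have e := rv_ge (n := n) (t := t) (i := ⟨t, htn⟩) le_rfl
    simp only at e
    rcases eq_or_lt_of_le (show t ≤ (rv n t ⟨t, htn⟩).val by omega) with h | h
    · have : rv n t ⟨t, htn⟩ = g (Fin.last _) := by rw [hl]; exact Fin.ext h.symm
      rw [this]
      exact hpg (Fin.castSucc_lt_last _)
    · exact (hp g hg hpg _ (by rw [hl]; exact h)).1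

/-- The witness `1 ⋯ (k-3) k (k-2) (k-1) (k+1) ⋯ n`. -/
def p0 (n m : ℕ) (h : m + 4 ≤ n) : Equiv.Perm (Fin n) where
  toFun i := if i.val = m then ⟨m + 2, by omega⟩ else if i.val = m + 1 then ⟨m, by omega⟩
    else if i.val = m + 2 then ⟨m + 1, by omega⟩ else i
  invFun i := if i.val = m + 2 then ⟨m, by omega⟩ else if i.val = m then ⟨m + 1, by omega⟩
    else if i.val = m + 1 then ⟨m + 2, by omega⟩ else i
  left_inv i := by
    simp only [Fin.ext_iff]
    split_ifs <;> simp_all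
  right_inv i := by
    simp only [Fin.ext_iff]
    split_ifs <;> simp_all

lemma p0_val {n m : ℕ} (h : m + 4 ≤ n) (i : Fin n) : (p0 n m h i : ℕ) =
    if i.val = m then m + 2 else if i.val = m + 1 then m
    else if i.val = m + 2 then m + 1 else i.val := by
  simp only [p0, Equiv.coe_fn_mk]
  split_ifs <;> rfl

lemma mono_ge {n k : ℕ} {g : Fin k → Fin n} (hg : StrictMono g) :
    ∀ (i : ℕ) (hi : i < k), i ≤ (g ⟨i, hi⟩ : ℕ) := by
  intro i
  induction i with
  | zero => intro _; omega
  | succ i ih =>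
    intro hi
    have h1 := ih (by omega)
    have h2 : g ⟨i, by omega⟩ < g ⟨i + 1, hi⟩ := hg (by simp [Fin.lt_def])
    rw [Fin.lt_def] at h2
    omega

lemma p0_no {n m : ℕ} (h : m + 4 ≤ n) (j : Fin n) (hj : j.val < m + 2) : ¬ L m (p0 n m h) j := by
  rintro ⟨g, hg, hpg, hl⟩
  have h1 := mono_ge hg m (by omega)
  have h2 : g ⟨m, by omega⟩ < g (Fin.last _) := hg (by simp [Fin.lt_def])
  have h3 : p0 n m h (g ⟨m, by omega⟩) < p0 n m h (g (Fin.last _)) :=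
    hpg (by simp [Fin.lt_def])
  rw [Fin.lt_def] at h2 h3
  rw [p0_val, p0_val] at h3
  rw [hl] at h2 h3
  split_ifs at h3 <;> omega

lemma p0_av1 {n m : ℕ} (h : m + 4 ≤ n) : AV1 m (p0 n m h) := by
  intro g hg hpg x hx
  have hge : m + 2 ≤ (g (Fin.last _)).val := by
    by_contra hlt
    exact p0_no h _ (not_le.1 hlt) ⟨g, hg, hpg, rfl⟩
  rw [Fin.lt_def] at *
  rw [p0_val, p0_val]
  split_ifs <;> omega

lemma p0_first {n m : ℕ} (h : m + 4 ≤ n) : First m (p0 n m h) (m + 2) := by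
  refine ⟨by omega, p0_no h, fun h' => ?_⟩
  refine ⟨fun a => if a.val < m then ⟨a.val, by omega⟩ else ⟨a.val + 1, by omega⟩, ?_, ?_, ?_⟩
  · intro a b hab
    rw [Fin.lt_def] at *
    simp only
    split_ifs <;> simp only <;> omega
  · intro a b hab
    rw [Fin.lt_def] at *
    simp only [Function.comp, p0_val]
    split_ifs <;> simp only at * <;> omega
  · simp

lemma p0_not {n m : ℕ} (h : m + 4 ≤ n) {p : Equiv.Perm (Fin n)} (hp : AV2 m p)
    (he : p * rv n (m + 2) = p0 n m h) : False := by
  have hv : ∀ i, p (rv n (m + 2) i) = p0 n m h i := fun i => by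
    rw [← he, Equiv.Perm.mul_apply]
  have hlt : ∀ i : Fin n, i.val < m + 2 → p i = p0 n m h i := fun i hi => by
    rw [← hv, rv_lt hi]
  have h1 : p ⟨m + 2, by omega⟩ = p0 n m h ⟨n - 1, by omega⟩ := by
    rw [← hv]; congr 1; apply Fin.ext; rw [rv_ge] <;> simp only <;> omega
  have h2 : p ⟨n - 1, by omega⟩ = p0 n m h ⟨m + 2, by omega⟩ := by
    rw [← hv]; congr 1; apply Fin.ext; rw [rv_ge] <;> simp only <;> omega
  let g : Fin (m + 2) → Fin n := Fin.snoc (α := fun _ => Fin n)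
    (fun a : Fin (m + 1) => ⟨a.val, by omega⟩) ⟨m + 2, by omega⟩
  have gl : g (Fin.last _) = ⟨m + 2, by omega⟩ := by simp [g]
  have gc : ∀ a : Fin (m + 1), g a.castSucc = ⟨a.val, by omega⟩ := by intro a; simp [g]
  have hg : StrictMono g := by
    intro a b hab
    induction b using Fin.lastCases with
    | last =>
      induction a using Fin.lastCases with
      | last => exact absurd hab (lt_irrefl _)
      | cast a => rw [gl, gc, Fin.lt_def]; simp only; omega
    | cast b =>
      induction a using Fin.lastCases with
      | last => exact absurd hab (not_lt.2 (Fin.le_last _))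
      | cast a => rw [gc, gc]; exact hab
  have hpg : StrictMono (p ∘ g) := by
    intro a b hab
    simp only [Function.comp]
    induction b using Fin.lastCases with
    | last =>
      induction a using Fin.lastCases with
      | last => exact absurd hab (lt_irrefl _)
      | cast a =>
        rw [gl, gc, h1, hlt _ (by simp only; omega), Fin.lt_def, p0_val, p0_val]
        simp only
        split_ifs <;> omega
    | cast b =>
      induction a using Fin.lastCases with
      | last => exact absurd hab (not_lt.2 (Fin.le_last _))
      | cast a =>
        have hab' : a.val < b.val := hab
        rw [gc, gc, hlt _ (by simp only; omega), hlt _ (by simp only; omega), Fin.lt_def,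
          p0_val, p0_val]
        simp only
        split_ifs <;> omega
  have := (hp g hg hpg ⟨n - 1, by omega⟩ (by rw [gl, Fin.lt_def]; simp only; omega)).1
  rw [gc, h2, hlt _ (by simp), Fin.lt_def, p0_val, p0_val] at this
  simp at this

end PatAv

open PatAv in
/-- For `n` large enough, `av_n(A_{k,k-1}) < av_n(A_{k,k})`. -/
theorem stmt15 (k : ℕ) (hk : 3 ≤ k) :
    ∃ N : ℕ, ∀ n : ℕ, N ≤ n → avSet n (Aki k (k - 1)) < avSet n (Aki k k) := by
  obtain ⟨m, rfl⟩ : ∃ m, k = m + 3 := ⟨k - 3, by omega⟩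
  refine ⟨m + 4, fun n hn => ?_⟩
  unfold avSet
  choose t ht using fun p : Equiv.Perm (Fin n) => first_exists (m := m) p
  let F : { p : Equiv.Perm (Fin n) // AvoidsSet p (Aki (m + 3) (m + 3 - 1)) } →
      { p : Equiv.Perm (Fin n) // AvoidsSet p (Aki (m + 3) (m + 3)) } :=
    fun p => ⟨p.1 * rv n (t p.1), (av1_iff _).2 (main ((av2_iff _).1 p.2) (ht p.1)).1⟩
  have hF : Function.Injective F := by
    rintro ⟨p, hp⟩ ⟨p', hp'⟩ h
    have h' : p * rv n (t p) = p' * rv n (t p') := congrArg Subtype.val h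
    have f1 := (main ((av2_iff _).1 hp) (ht p)).2
    have f2 := (main ((av2_iff _).1 hp') (ht p')).2
    rw [← h'] at f2
    have := first_unique f1 f2
    rw [← this] at h'
    exact Subtype.ext (mul_right_cancel h')
  have hS : (⟨p0 n m hn, (av1_iff _).2 (p0_av1 hn)⟩ :
      { p : Equiv.Perm (Fin n) // AvoidsSet p (Aki (m + 3) (m + 3)) }) ∉ Set.range F := by
    rintro ⟨⟨p, hp⟩, h⟩
    have h' : p * rv n (t p) = p0 n m hn := congrArg Subtype.val h
    have f1 := (main ((av2_iff _).1 hp) (ht p)).2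
    rw [h'] at f1
    have := first_unique f1 (p0_first hn)
    rw [this] at h'
    exact p0_not hn ((av2_iff _).1 hp) h'
  classical
  rw [Nat.card_eq_fintype_card, Nat.card_eq_fintype_card]
  exact Fintype.card_lt_of_injective_of_notMem F hF hS
end
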